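/- arXiv:2312.03229 — 12 statements merged into one kernel-verified Lean document; each statement's English description precedes it below -/
import Mathlib

section
/- For all natural numbers p ≥ 1 and n ≥ 2p, there exists a finite strategic-form game G with n players, each having strategy set {a, b}, and Nash equilibria s (in which every player plays a) and d (in which every player plays b), such that some set of exactly p players is a direct control set with respect to (G, s, d), while no set of fewer than p players is a direct control set with respect to (G, s, d). (Such a game is obtained by giving each player i the utility u_i(x) = 1 if at least p + 1 players, including i, play the same strategy as i, and u_i(x) = 0 otherwise.) -/
/-- `x` is a best response of player `i` to profile `t`:
`u_i(x, t_{-i}) ≥ u_i(y, t_{-i})` for every strategy `y` of `i`. -/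
def BestResponse {ι : Type*} [DecidableEq ι] {S : ι → Type*}
    (u : ι → (∀ j, S j) → ℝ) (i : ι) (x : S i) (t : ∀ j, S j) : Prop :=
  ∀ y : S i, u i (Function.update t i y) ≤ u i (Function.update t i x)

/-- `s` is a Nash equilibrium: every `s i` is a best response of `i` to `s`. -/
def NashEq {ι : Type*} [DecidableEq ι] {S : ι → Type*}
    (u : ι → (∀ j, S j) → ℝ) (s : ∀ j, S j) : Prop :=
  ∀ i, BestResponse u i (s i) s

/-- The profile in which the players in `A` play `d` and all the others play `s`. -/
def mixed {ι : Type*} [DecidableEq ι] {S : ι → Type*}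
    (A : Finset ι) (d s : ∀ j, S j) : ∀ j, S j :=
  fun j => if j ∈ A then d j else s j

/-- `A` is a direct control set with respect to `(G, s, d)`: for every player `i ∉ A`,
`d i` is a best response of `i` to the profile `((d_j)_{j ∈ A}, (s_j)_{j ∉ A})`. -/
def IsDCS {ι : Type*} [DecidableEq ι] {S : ι → Type*}
    (u : ι → (∀ j, S j) → ℝ) (s d : ∀ j, S j) (A : Finset ι) : Prop :=
  ∀ i ∉ A, BestResponse u i (d i) (mixed A d s)

/-- The threshold coordination game: player `i` gets `1` if at least `p + 1` players, including
`i`, play the strategy of `i`, and `0` otherwise. -/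
noncomputable def thresholdUtility {ι : Type*} [Fintype ι] (p : ℕ) (i : ι) (x : ι → Bool) : ℝ :=
  if p + 1 ≤ (Finset.univ.filter fun j => x j = x i).card then 1 else 0

theorem thresholdUtility_le_one {ι : Type*} [Fintype ι] (p : ℕ) (i : ι) (x : ι → Bool) :
    thresholdUtility p i x ≤ 1 := by
  unfold thresholdUtility
  split_ifs <;> norm_num

theorem nashEq_thresholdUtility_const {ι : Type*} [Fintype ι] [DecidableEq ι] {p : ℕ}
    (h : p + 1 ≤ Fintype.card ι) (b : Bool) :
    NashEq (S := fun _ : ι => Bool) (thresholdUtility p) (fun _ => b) := by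
  intro i y
  have hu : thresholdUtility p i (fun _ : ι => b) = 1 := by
    simp [thresholdUtility, h]
  rw [Function.update_eq_self i (fun _ : ι => b), hu]
  exact thresholdUtility_le_one p i _

theorem thresholdUtility_update_mixed_true {ι : Type*} [Fintype ι] [DecidableEq ι] (p : ℕ)
    {A : Finset ι} {i : ι} (hi : i ∉ A) :
    thresholdUtility p i (Function.update
      (mixed (S := fun _ => Bool) A (fun _ => true) (fun _ => false)) i true) =
      if p ≤ A.card then 1 else 0 := by
  have hs : (Finset.univ.filter fun j => Function.update
      (mixed (S := fun _ => Bool) A (fun _ => true) (fun _ => false)) i true j = true) =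
      insert i A := by
    ext j
    by_cases hj : j = i <;> simp [mixed, Function.update_apply, hj]
  simp only [thresholdUtility, Function.update_self, hs, Finset.card_insert_of_notMem hi,
    Nat.add_le_add_iff_right]

theorem thresholdUtility_update_mixed_false {ι : Type*} [Fintype ι] [DecidableEq ι] (p : ℕ)
    {A : Finset ι} {i : ι} (hi : i ∉ A) :
    thresholdUtility p i (Function.update
      (mixed (S := fun _ => Bool) A (fun _ => true) (fun _ => false)) i false) =
      if p + 1 ≤ Fintype.card ι - A.card then 1 else 0 := by
  have hs : (Finset.univ.filter fun j => Function.update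
      (mixed (S := fun _ => Bool) A (fun _ => true) (fun _ => false)) i false j = false) = Aᶜ := by
    ext j
    by_cases hj : j = i <;> simp [mixed, Function.update_apply, hj, hi]
  simp only [thresholdUtility, Function.update_self, hs, Finset.card_compl]

/-- For all `p ≥ 1` and `n ≥ 2p` there is a game with `n` players, strategy sets
`{a, b}` (here `Bool`, with `a = false` and `b = true`), Nash equilibria
`s = (a,…,a)` and `d = (b,…,b)`, such that some set of exactly `p` players is a
direct control set w.r.t. `(G, s, d)`, while no set of fewer than `p` players is. -/
theorem stmt1 (p n : ℕ) (hp : 1 ≤ p) (hn : 2 * p ≤ n) :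
    ∃ u : Fin n → ((Fin n → Bool) → ℝ),
      NashEq u (fun _ => false) ∧ NashEq u (fun _ => true) ∧
      (∃ A : Finset (Fin n), A.card = p ∧
        IsDCS u (fun _ => false) (fun _ => true) A) ∧
      (∀ A : Finset (Fin n), A.card < p →
        ¬ IsDCS u (fun _ => false) (fun _ => true) A) := by
  have hc : p + 1 ≤ Fintype.card (Fin n) := by
    rw [Fintype.card_fin]
    omega
  refine ⟨thresholdUtility p, nashEq_thresholdUtility_const hc _,
    nashEq_thresholdUtility_const hc _, ?_, fun A hA h => ?_⟩
  · obtain ⟨A, -, hA⟩ := Finset.exists_subset_card_eq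
      (s := (Finset.univ : Finset (Fin n))) (n := p) (by rw [Finset.card_univ]; omega)
    refine ⟨A, hA, fun i hi y => ?_⟩
    rw [thresholdUtility_update_mixed_true p hi, if_pos hA.ge]
    exact thresholdUtility_le_one p i _
  · obtain ⟨i, hi⟩ : ∃ i, i ∉ A := by
      by_contra! hall
      rw [Finset.eq_univ_of_forall hall, Finset.card_univ] at hA
      omega
    have hle := h i hi false
    rw [thresholdUtility_update_mixed_true p hi, thresholdUtility_update_mixed_false p hi,
      if_pos (by rw [Fintype.card_fin]; omega), if_neg (by omega)] at hle
    norm_num at hle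
end

section
/- For every n ≥ 2 there exists a finite strategic-form game G with n players and Nash equilibria s and d such that no set of fewer than n − 1 players is a direct control set with respect to (G, s, d). (Such a game is obtained by giving every player the strategy set {a, b} and the utility that equals 1 if all players play a, equals 1 if all players play b, and otherwise equals 1 for players playing a and 0 for players playing b; here s is the all-a profile and d is the all-b profile.) -/
/-- For every `n ≥ 2` there is a game with `n` players (each with a two-element
strategy set) and Nash equilibria `s` and `d` such that no set of fewer than
`n - 1` players is a direct control set w.r.t. `(G, s, d)`. -/
theorem stmt2 (n : ℕ) (hn : 2 ≤ n) :
    ∃ (u : Fin n → ((Fin n → Bool) → ℝ)) (s d : Fin n → Bool),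
      NashEq u s ∧ NashEq u d ∧
      ∀ A : Finset (Fin n), A.card < n - 1 → ¬ IsDCS u s d A := by
  refine ⟨fun i t => if t i = false ∨ ∀ j, t j = true then 1 else 0,
    fun _ => false, fun _ => true, ?_, ?_, ?_⟩
  · intro i y
    simp only [Function.update_self, true_or, if_true]
    split_ifs <;> norm_num
  · intro i y
    have h : ∀ j, Function.update (fun _ : Fin n => true) i true j = true := by
      simp [Function.update_apply]
    simp only [h, implies_true, or_true, if_true]
    split_ifs <;> norm_num
  · intro A hA hdcs
    have hcard : 1 < Aᶜ.card := by
      rw [Finset.card_compl, Fintype.card_fin]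
      omega
    obtain ⟨i, hi, j, hj, hij⟩ := Finset.one_lt_card.mp hcard
    rw [Finset.mem_compl] at hi hj
    have hle := hdcs i hi false
    have hne : ¬ ∀ k, Function.update (mixed A (fun _ => true) fun _ => false) i true k = true := by
      intro h
      simpa [Function.update_of_ne hij.symm, mixed, hj] using h j
    simp only [Function.update_self, true_or, if_true, hne, or_false, Bool.true_eq_false,
      if_false] at hle
    norm_num at hle
end

section
/- Let G be a finite strategic-form game with n players and let d be a Nash equilibrium of G. Assume: (1) for every strategy profile s, every subset of players of size at least m is a direct control set with respect to (G, s, d); and (2) for every player j and every subprofile s_{-j} of the other players, u_j(d) ≥ u_j(d_j, s_{-j}). Then d is an (n − m)-strong Nash equilibrium. -/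
/-- `s` is a `k`-strong Nash equilibrium: no coalition `K` with `|K| ≤ k` has a joint
deviation in which nobody in `K` loses and somebody in `K` gains. -/
def IsKStrong {ι : Type*} [DecidableEq ι] {S : ι → Type*}
    (u : ι → (∀ j, S j) → ℝ) (s : ∀ j, S j) (k : ℕ) : Prop :=
  ¬ ∃ (K : Finset ι) (t : ∀ j, S j), K.card ≤ k ∧
      (∀ i ∈ K, u i s ≤ u i (mixed K t s)) ∧ (∃ i ∈ K, u i s < u i (mixed K t s))

/-- If (1) for every profile `s`, every set of at least `m` players is a direct
control set w.r.t. `(G, s, d)`, and (2) for every player `j` and every subprofile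
of the others, `u_j(d) ≥ u_j(d_j, s_{-j})`, then the Nash equilibrium `d` is an
`(n - m)`-strong Nash equilibrium. -/
theorem stmt3 {ι : Type*} [Fintype ι] [DecidableEq ι] {S : ι → Type*}
    [∀ i, Fintype (S i)] [∀ i, Nonempty (S i)]
    (u : ι → (∀ j, S j) → ℝ) (d : ∀ j, S j) (m : ℕ) (hd : NashEq u d)
    (h1 : ∀ (s : ∀ j, S j) (A : Finset ι), m ≤ A.card → IsDCS u s d A)
    (h2 : ∀ (j : ι) (s : ∀ j, S j), u j (Function.update s j (d j)) ≤ u j d) :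
    IsKStrong u d (Fintype.card ι - m) := by
  rintro ⟨K, t, hK, -, i, hi, hlt⟩
  have hpos : 0 < K.card := Finset.card_pos.mpr ⟨i, hi⟩
  have hcompl : m ≤ Kᶜ.card := by
    rw [Finset.card_compl]
    omega
  have hmixed : mixed Kᶜ d t = mixed K t d := by
    funext j
    by_cases hj : j ∈ K <;> simp [mixed, hj]
  have hself : Function.update (mixed K t d) i (t i) = mixed K t d := by
    rw [Function.update_eq_self_iff]
    simp [mixed, hi]
  have hbest := h1 t Kᶜ hcompl i (by simpa using hi) (t i)
  rw [hmixed, hself] at hbest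
  exact absurd (hbest.trans (h2 i (mixed K t d))) hlt.not_ge
end

section
/- For every n and every m with 1 ≤ m < n, there exists a finite strategic-form game G with n players and a Nash equilibrium d such that: (1) for every strategy profile s, every subset of players of size at least m is a direct control set with respect to (G, s, d); (2) for every player j and every subprofile s_{-j}, u_j(d) ≥ u_j(d_j, s_{-j}); and yet (3) d is not an (n − m + 1)-strong Nash equilibrium. (Such a game is the symmetric game with strategies {a, b} in which a player i gets utility 1 if x_i = a and at least m + 1 players play a, utility 2 if x_i = b and at least n − m + 1 players play b, and 0 otherwise, with d the all-a profile.) -/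
/-- The threshold game in which a player of `true` gets `1` if at least `m + 1` players play
`true`, and a player of `false` gets `2` if at least `n - m + 1` players play `false`; all other
payoffs are `0`. -/
def thresholdGame (n m : ℕ) (i : Fin n) (x : Fin n → Bool) : ℝ :=
  if x i = true then
    if m + 1 ≤ (Finset.univ.filter fun j => x j = true).card then 1 else 0
  else
    if n - m + 1 ≤ (Finset.univ.filter fun j => x j = false).card then 2 else 0

theorem thresholdGame_le_one_of_eq_true {n m : ℕ} {i : Fin n} {x : Fin n → Bool}
    (h : x i = true) : thresholdGame n m i x ≤ 1 := by
  rw [thresholdGame, if_pos h]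
  split_ifs <;> norm_num

theorem thresholdGame_const_true {n m : ℕ} (hmn : m < n) (i : Fin n) :
    thresholdGame n m i (fun _ => true) = 1 := by
  have : m + 1 ≤ n := hmn
  simp [thresholdGame, this]

/-- If at least `m` opponents of `i` play `true`, then `true` is a best response of `i`. -/
theorem bestResponse_thresholdGame_true {n m : ℕ} {i : Fin n} {x : Fin n → Bool}
    {A : Finset (Fin n)} (hA : m ≤ A.card) (hi : i ∉ A) (hx : ∀ j ∈ A, x j = true) :
    BestResponse (thresholdGame n m) i true x := by
  have hupd : ∀ y : Bool, ∀ j ∈ A, Function.update x i y j = true := fun y j hj => by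
    rw [Function.update_of_ne (ne_of_mem_of_not_mem hj hi), hx j hj]
  rintro (_ | _)
  · have hle : (Finset.univ.filter fun j => Function.update x i false j = false).card
        ≤ n - m := by
      have hsub : (Finset.univ.filter fun j => Function.update x i false j = false) ⊆ Aᶜ := by
        intro j hj
        rw [Finset.mem_compl]
        intro hjA
        simp [hupd false j hjA] at hj
      have hcard := Finset.card_le_card hsub
      rw [Finset.card_compl, Fintype.card_fin] at hcard
      omega
    have hzero : thresholdGame n m i (Function.update x i false) = 0 := by
      rw [thresholdGame, if_neg (by simp), if_neg (by omega)]
    rw [hzero, thresholdGame]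
    split_ifs <;> norm_num
  · exact le_rfl

/-- Tightness of the strength bound: for every `n` and `1 ≤ m < n` there is a game
with `n` players (strategy sets `Bool`) and a Nash equilibrium `d` satisfying both
hypotheses of the strength theorem, and yet `d` is not an `(n - m + 1)`-strong
Nash equilibrium. -/
theorem stmt4 (n m : ℕ) (hm : 1 ≤ m) (hmn : m < n) :
    ∃ (u : Fin n → ((Fin n → Bool) → ℝ)) (d : Fin n → Bool),
      NashEq u d ∧
      (∀ (s : Fin n → Bool) (A : Finset (Fin n)), m ≤ A.card → IsDCS u s d A) ∧
      (∀ (j : Fin n) (s : Fin n → Bool),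
        u j (Function.update s j (d j)) ≤ u j d) ∧
      ¬ IsKStrong u d (n - m + 1) := by
  refine ⟨thresholdGame n m, fun _ => true, fun i => ?_, fun s A hA i hi => ?_,
    fun j s => ?_, ?_⟩
  · refine bestResponse_thresholdGame_true (A := {i}ᶜ) ?_ (by simp) fun _ _ => rfl
    rw [Finset.card_compl, Fintype.card_fin, Finset.card_singleton]
    omega
  · exact bestResponse_thresholdGame_true hA hi fun j hj => by simp [mixed, hj]
  · rw [thresholdGame_const_true hmn]
    exact thresholdGame_le_one_of_eq_true (by simp)
  · obtain ⟨K, -, hK⟩ := Finset.exists_subset_card_eq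
      (s := (Finset.univ : Finset (Fin n))) (n := n - m + 1)
      (by rw [Finset.card_univ, Fintype.card_fin]; omega)
    have hgain : ∀ i ∈ K,
        thresholdGame n m i (mixed K (fun _ => false) fun _ => true) = 2 := by
      intro i hi
      have hfalse : (Finset.univ.filter fun j =>
          mixed K (fun _ => false) (fun _ => true) j = false) = K := by
        ext j
        simp [mixed]
      rw [thresholdGame, if_neg (by simp [mixed, hi]), if_pos (by rw [hfalse, hK])]
    refine not_not_intro ⟨K, fun _ => false, hK.le, fun i hi => ?_, ?_⟩
    · rw [hgain i hi, thresholdGame_const_true hmn]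
      norm_num
    · obtain ⟨i, hi⟩ := Finset.card_pos.mp (by omega : 0 < K.card)
      refine ⟨i, hi, ?_⟩
      rw [hgain i hi, thresholdGame_const_true hmn]
      norm_num
end

section
/- Being a direct control set is not monotone with respect to inclusion: there exists a finite strategic-form game G, Nash equilibria s and d of G, and sets of players A ⊆ A' ⊆ N such that A is a direct control set with respect to (G, s, d) but A' is not a direct control set with respect to (G, s, d). -/
/-- A three-player game in which the only payoff at stake is a penalty for player `2` when she
plays `1` while players `0` and `1` disagree. -/
def disagreementGame (i : Fin 3) (t : Fin 3 → Fin 2) : ℝ :=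
  if i = 2 ∧ t 2 = 1 ∧ t 0 ≠ t 1 then -1 else 0

/-- A strategy that avoids the penalty is a best response. -/
theorem disagreementGame_bestResponse {i : Fin 3} {x : Fin 2} {t : Fin 3 → Fin 2}
    (h : ¬ (i = 2 ∧ Function.update t i x 2 = 1 ∧
      Function.update t i x 0 ≠ Function.update t i x 1)) :
    BestResponse disagreementGame i x t := by
  intro y
  rw [disagreementGame, disagreementGame, if_neg h]
  split_ifs <;> norm_num

/-- Being a direct control set is not monotone w.r.t. inclusion: there is a finite
game, Nash equilibria `s` and `d`, and sets `A ⊆ A'` such that `A` is a direct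
control set w.r.t. `(G, s, d)` but `A'` is not. -/
theorem stmt8 :
    ∃ (n k : ℕ) (u : Fin n → ((Fin n → Fin k) → ℝ)) (s d : Fin n → Fin k)
      (A A' : Finset (Fin n)),
      NashEq u s ∧ NashEq u d ∧ A ⊆ A' ∧
      IsDCS u s d A ∧ ¬ IsDCS u s d A' := by
  refine ⟨3, 2, disagreementGame, fun _ => 0, fun _ => 1, ∅, {0}, ?_, ?_, Finset.empty_subset _,
    ?_, ?_⟩
  · intro i
    apply disagreementGame_bestResponse
    decide +revert
  · intro i
    apply disagreementGame_bestResponse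
    decide +revert
  · intro i _
    apply disagreementGame_bestResponse
    decide +revert
  · intro h
    have h2 := h 2 (by decide) 0
    rw [disagreementGame, disagreementGame, if_neg (by decide), if_pos (by decide)] at h2
    norm_num at h2
end

section
/- Let (E_l)_{l∈I} be a finite collection of nonempty finite subsets of a finite ground set U with I and U disjoint. Define the game with player set N = I ∪ U, strategy sets S_i = {0, 1} for all i, constant utility for every player in U, and for l ∈ I the utility u_l(x) = 1 if x_l = 1 and x_i = 1 for some i ∈ E_l, u_l(x) = −1 if x_l = 1 and x_i = 0 for all i ∈ E_l, and u_l(x) = 0 if x_l = 0. Let s be the all-0 profile and d the all-1 profile. Then s and d are Nash equilibria, and a set A ⊆ U is a direct control set with respect to this game, s, and d if and only if A ∩ E_l ≠ ∅ for every l ∈ I (i.e., A is a hitting set of the collection). -/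
open scoped Classical in
/-- The hitting-set game: players are `I ⊕ U`, each with strategies `{0, 1}`
(`Bool`), players in `U` have constant utility, and a player `l ∈ I` playing `1`
gets `1` if some member of `E l` plays `1` and `-1` otherwise (and `0` when playing
`0`). The all-`0` profile `s` and the all-`1` profile `d` are Nash equilibria, and
a set `A ⊆ U` is a direct control set w.r.t. `(G, s, d)` iff `A` is a hitting set
of the collection `(E l)_{l ∈ I}`. -/
theorem stmt11 {I U : Type*} [Fintype I] [Fintype U] [DecidableEq I] [DecidableEq U]
    (E : I → Finset U) (hE : ∀ l, (E l).Nonempty) :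
    let u : I ⊕ U → ((I ⊕ U → Bool) → ℝ) := fun p x =>
      match p with
      | Sum.inl l => if x (Sum.inl l) = true then
            (if ∃ i ∈ E l, x (Sum.inr i) = true then 1 else -1)
          else 0
      | Sum.inr _ => 0
    let s : I ⊕ U → Bool := fun _ => false
    let d : I ⊕ U → Bool := fun _ => true
    NashEq u s ∧ NashEq u d ∧
      ∀ A : Finset U,
        IsDCS u s d (A.image Sum.inr) ↔ ∀ l : I, ∃ i ∈ E l, i ∈ A := by
  intro u s d
  refine ⟨?_, ?_, fun A => ⟨fun h l => ?_, ?_⟩⟩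
  · rintro (l | i) y
    · cases y <;> simp [u, s]
    · exact le_rfl
  · rintro (l | i) y
    · have : ∃ i, i ∈ E l := hE l
      cases y <;> simp [u, d, this]
    · exact le_rfl
  · by_contra hA
    have := h (Sum.inl l) (by simp) false
    simp only [u, s, d, mixed, Function.update_self, ne_eq, reduceCtorEq, not_false_eq_true,
      Function.update_of_ne] at this
    simp [hA] at this
    linarith
  · rintro h (l | i) - y
    · have := h l
      cases y <;> simp [u, s, d, mixed, this]
    · exact le_rfl
end

section
/- Let G be a finite strategic-form game, let i be a player, and let M ⊆ N∖{i} be a set of players such that u_i(t) = u_i(t') whenever profiles t and t' satisfy t_j = t'_j for every j ∈ M ∪ {i} (i.e., u_i depends only on the strategies of i and of the players in M). Let s and d be profiles and let A be a direct control set with respect to (G, s, d) with i ∉ A and A ∩ M = ∅. Then d_i is a best response of i to the profile s. -/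
/-- If player `i`'s utility depends only on the strategies of `i` and of the
players in `M`, and `A` is a direct control set w.r.t. `(G, s, d)` with `i ∉ A` and
`A ∩ M = ∅`, then `d i` is a best response of `i` to the profile `s`. -/
theorem stmt12 {ι : Type*} [Fintype ι] [DecidableEq ι] {S : ι → Type*}
    [∀ i, Fintype (S i)] [∀ i, Nonempty (S i)]
    (u : ι → (∀ j, S j) → ℝ) (s d : ∀ j, S j) (i : ι) (M : Finset ι) (hiM : i ∉ M)
    (hloc : ∀ t t' : ∀ j, S j, (∀ j, j ∈ M ∨ j = i → t j = t' j) → u i t = u i t')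
    (A : Finset ι) (hA : IsDCS u s d A) (hiA : i ∉ A) (hAM : Disjoint A M) :
    BestResponse u i (d i) s := by
  have key : ∀ x : S i,
      u i (Function.update s i x) = u i (Function.update (mixed A d s) i x) := by
    intro x
    apply hloc
    intro j hj
    by_cases h : j = i
    · subst h
      simp
    · have hjA : j ∉ A := Finset.disjoint_right.mp hAM (hj.resolve_right h)
      simp [h, mixed, hjA]
  intro y
  rw [key, key]
  exact hA i hiA y
end

section
/- Let G be a singleton congestion game with n players, m ≥ 1 resources, and nondecreasing cost functions c_r : ℕ → ℝ. Let s be any strategy profile and let d be a Nash equilibrium. Let r be a resource maximizing |P_r(d)|. Then the set A = N ∖ P_r(d) is a direct control set with respect to (G, s, d); in particular, there exists a direct control set with respect to (G, s, d) of size at most n − ⌈n/m⌉. -/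
/-- The load of resource `r` in profile `s` of a singleton congestion game. -/
def load {ι ρ : Type*} [Fintype ι] [DecidableEq ρ] (s : ι → ρ) (r : ρ) : ℕ :=
  (Finset.univ.filter (fun i => s i = r)).card

/-- The cost player `i` incurs after switching her choice to resource `x`. -/
def switchCost {ι ρ : Type*} [Fintype ι] [DecidableEq ι] [DecidableEq ρ]
    (c : ρ → ℕ → ℝ) (s : ι → ρ) (i : ι) (x : ρ) : ℝ :=
  c x (load (Function.update s i x) x)

/-- Resource `x` is a best response of player `i` to profile `s`: switching `i`'s
choice to `x` minimises her resulting cost over all resources. -/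
def IsBR {ι ρ : Type*} [Fintype ι] [DecidableEq ι] [DecidableEq ρ]
    (c : ρ → ℕ → ℝ) (i : ι) (x : ρ) (s : ι → ρ) : Prop :=
  ∀ y : ρ, switchCost c s i x ≤ switchCost c s i y

/-- `s` is a Nash equilibrium of the singleton congestion game. -/
def NashC {ι ρ : Type*} [Fintype ι] [DecidableEq ι] [DecidableEq ρ]
    (c : ρ → ℕ → ℝ) (s : ι → ρ) : Prop :=
  ∀ i, IsBR c i (s i) s

/-- `A` is a direct control set with respect to `(G, s, d)` in a singleton congestion
game: every player `i ∉ A` has `d i` as a best response to the profile in which the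
players of `A` play `d` and the rest play `s`. -/
def DCSC {ι ρ : Type*} [Fintype ι] [DecidableEq ι] [DecidableEq ρ]
    (c : ρ → ℕ → ℝ) (s d : ι → ρ) (A : Finset ι) : Prop :=
  ∀ i ∉ A, IsBR c i (d i) (fun j => if j ∈ A then d j else s j)

theorem load_mono_of_imp {ι ρ : Type*} [Fintype ι] [DecidableEq ρ] {s t : ι → ρ} {r : ρ}
    (h : ∀ j, s j = r → t j = r) : load s r ≤ load t r :=
  Finset.card_le_card (Finset.monotone_filter_right _ fun j _ hj => h j hj)

theorem sum_load {ι ρ : Type*} [Fintype ι] [Fintype ρ] [DecidableEq ρ] (s : ι → ρ) :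
    ∑ q, load s q = Fintype.card ι :=
  (Finset.card_eq_sum_card_fiberwise (f := s) (s := Finset.univ) (t := Finset.univ)
    (fun _ _ => by simp)).symm

/-- If no resource is used more than `r`, then `r` is used by at least `⌈n / m⌉` players. -/
theorem ceil_card_div_card_le_load {ι ρ : Type*} [Fintype ι] [Fintype ρ] [DecidableEq ρ]
    (s : ι → ρ) (r : ρ) (hr : ∀ q, load s q ≤ load s r) :
    ⌈(Fintype.card ι : ℚ) / (Fintype.card ρ : ℚ)⌉₊ ≤ load s r := by
  have hcard : Fintype.card ι ≤ load s r * Fintype.card ρ := by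
    rw [← sum_load s, mul_comm]
    simpa using Finset.sum_le_card_nsmul Finset.univ (load s) (load s r) fun q _ => hr q
  have : Nonempty ρ := ⟨r⟩
  have hpos : (0 : ℚ) < Fintype.card ρ := by exact_mod_cast Fintype.card_pos
  rw [Nat.ceil_le, div_le_iff₀ hpos]
  exact_mod_cast hcard

theorem card_filter_ne_add_load {ι ρ : Type*} [Fintype ι] [DecidableEq ρ] (s : ι → ρ) (r : ρ) :
    (Finset.univ.filter fun i => s i ≠ r).card + load s r = Fintype.card ι := by
  rw [add_comm]
  exact Finset.card_filter_add_card_filter_not (s := Finset.univ) (fun i => s i = r)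

/-- Fixing a Nash equilibrium `d` on all players outside a single resource `r` directly
controls the remaining players. -/
theorem NashC.dcsc_filter_ne {ι ρ : Type*} [Fintype ι] [DecidableEq ι] [DecidableEq ρ]
    {c : ρ → ℕ → ℝ} (hmono : ∀ r, Monotone (c r)) (s : ι → ρ) {d : ι → ρ} (hd : NashC c d)
    (r : ρ) : DCSC c s d (Finset.univ.filter fun i => d i ≠ r) := by
  intro i hi y
  have hir : d i = r := by simpa using hi
  by_cases hy : y = d i
  · rw [hy]
  refine le_trans (hmono _ (load_mono_of_imp (t := Function.update d i (d i)) ?_))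
    ((hd i y).trans (hmono _ (load_mono_of_imp ?_)))
  · intro j hj
    by_cases hji : j = i
    · simp [hji]
    · by_cases hjr : d j = r <;> simp_all
  · intro j hj
    by_cases hji : j = i
    · simp [hji]
    · have hjy : d j = y := by simpa [hji] using hj
      have hyr : y ≠ r := hir ▸ hy
      simp [hji, hjy, hyr]

/-- In a singleton congestion game with nondecreasing costs, if `d` is a Nash
equilibrium and `r` is a resource maximising `|P_r(d)|`, then `N ∖ P_r(d)` is a
direct control set w.r.t. `(G, s, d)` for any profile `s`; in particular there is a
direct control set of size at most `n - ⌈n / m⌉`. -/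
theorem stmt13 {ι ρ : Type*} [Fintype ι] [DecidableEq ι] [Fintype ρ] [DecidableEq ρ]
    [Nonempty ρ] (c : ρ → ℕ → ℝ) (hmono : ∀ r, Monotone (c r))
    (s d : ι → ρ) (hd : NashC c d) (r : ρ) (hr : ∀ q : ρ, load d q ≤ load d r) :
    DCSC c s d (Finset.univ.filter (fun i => d i ≠ r)) ∧
      ∃ A : Finset ι, DCSC c s d A ∧
        A.card ≤ Fintype.card ι - ⌈(Fintype.card ι : ℚ) / (Fintype.card ρ : ℚ)⌉₊ := by
  refine ⟨hd.dcsc_filter_ne hmono s r, _, hd.dcsc_filter_ne hmono s r, ?_⟩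
  have hceil := ceil_card_div_card_le_load d r hr
  have hcard := card_filter_ne_add_load d r
  omega
end

section
/- For every m ≥ 2 and every n divisible by m, consider the singleton congestion game with n players, resources R = {1, …, m}, and cost functions c_j(x) = j + m(x − 1). There exist Nash equilibria s and d of this game with s_i ≠ d_i for every player i (e.g., s any profile with exactly n/m players on each resource and d obtained from s by cyclically shifting every player to the next resource), such that every direct control set with respect to (G, s, d) has size at least n − n/m. -/
theorem load_update_of_ne {ι ρ : Type*} [Fintype ι] [DecidableEq ι] [DecidableEq ρ]
    (s : ι → ρ) (i : ι) (x : ρ) (h : s i ≠ x) :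
    load (Function.update s i x) x = load s x + 1 := by
  unfold load
  rw [← Finset.card_insert_of_notMem (s := Finset.univ.filter fun j => s j = x) (a := i)
    (by simp [h])]
  congr 1
  ext j
  by_cases hj : j = i
  · subst hj; simp
  · simp [hj]

theorem load_update_le {ι ρ : Type*} [Fintype ι] [DecidableEq ι] [DecidableEq ρ]
    (s : ι → ρ) (i : ι) (x : ρ) :
    load (Function.update s i x) x ≤ load s x + 1 := by
  by_cases h : s i = x
  · subst h; simp
  · exact (load_update_of_ne s i x h).le

theorem load_perm_comp {ι ρ : Type*} [Fintype ι] [DecidableEq ρ]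
    (s : ι → ρ) (σ : Equiv.Perm ρ) (r : ρ) :
    load (fun i => σ (s i)) r = load s (σ.symm r) := by
  simp only [load, ← Equiv.eq_symm_apply]

theorem load_fst_finProdFinEquiv_symm (m k : ℕ) (r : Fin m) :
    load (fun i : Fin (m * k) => (finProdFinEquiv.symm i).1) r = k := by
  have h : Finset.univ.filter (fun i : Fin (m * k) => (finProdFinEquiv.symm i).1 = r)
      = Finset.univ.map ((Function.Embedding.sectR r (Fin k)).trans
          finProdFinEquiv.toEmbedding) := by
    ext i
    obtain ⟨⟨a, b⟩, rfl⟩ := finProdFinEquiv.surjective i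
    simp only [Finset.mem_filter, Finset.mem_univ, true_and, Equiv.symm_apply_apply,
      Finset.mem_map, Function.Embedding.trans_apply, Function.Embedding.sectR_apply,
      Equiv.coe_toEmbedding, EmbeddingLike.apply_eq_iff_eq, Prod.mk.injEq]
    exact ⟨fun h => ⟨b, h.symm, rfl⟩, fun ⟨_, h, _⟩ => h.symm⟩
  rw [load, h, Finset.card_map, Finset.card_univ, Fintype.card_fin]

/-- The cost function `c_j(x) = j + m (x - 1)`, for resources indexed from zero. -/
def slopeCost (m : ℕ) (j : Fin m) (x : ℕ) : ℝ :=
  ((j : ℕ) + 1 : ℝ) + (m : ℝ) * ((x : ℝ) - 1)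

theorem slopeCost_mono {m : ℕ} (j : Fin m) {x y : ℕ} (h : x ≤ y) :
    slopeCost m j x ≤ slopeCost m j y := by
  unfold slopeCost
  gcongr

theorem slopeCost_le_succ {m : ℕ} (j j' : Fin m) (x : ℕ) :
    slopeCost m j x ≤ slopeCost m j' (x + 1) := by
  have h : ((j : ℕ) : ℝ) ≤ m := by exact_mod_cast j.isLt.le
  have h' : (0 : ℝ) ≤ ((j' : ℕ) : ℝ) := Nat.cast_nonneg _
  unfold slopeCost
  push_cast
  linarith

theorem eq_of_slopeCost_eq {m : ℕ} {j j' : Fin m} {x y : ℕ}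
    (h : slopeCost m j x = slopeCost m j' y) : j = j' := by
  have h' : (j : ℕ) + m * x = (j' : ℕ) + m * y := by
    unfold slopeCost at h
    have : ((j : ℕ) : ℝ) + m * x = ((j' : ℕ) : ℝ) + m * y := by linarith
    exact_mod_cast this
  have hmod := congrArg (· % m) h'
  simp only [Nat.add_mul_mod_self_left, Nat.mod_eq_of_lt j.isLt, Nat.mod_eq_of_lt j'.isLt] at hmod
  exact Fin.ext hmod

theorem nashC_slopeCost_of_load_eq {ι : Type*} [Fintype ι] [DecidableEq ι] {m k : ℕ}
    (s : ι → Fin m) (hs : ∀ r, load s r = k) : NashC (slopeCost m) s := by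
  intro i y
  by_cases hy : s i = y
  · rw [hy]
  · simp only [switchCost, load_update_of_ne s i y hy, Function.update_eq_self, hs]
    exact slopeCost_le_succ _ _ _

/-- Players outside a direct control set all have the same target resource: it is the unique
resource that is cheapest to join in the intermediate profile. -/
theorem DCSC.target_eq {ι : Type*} [Fintype ι] [DecidableEq ι] {m : ℕ}
    {s d : ι → Fin m} (hsd : ∀ i, s i ≠ d i) {A : Finset ι} (hA : DCSC (slopeCost m) s d A)
    {i j : ι} (hi : i ∉ A) (hj : j ∉ A) : d i = d j := by
  set p : ι → Fin m := fun j => if j ∈ A then d j else s j with hp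
  have cheapest : ∀ i ∉ A, ∀ y, slopeCost m (d i) (load p (d i) + 1)
      ≤ slopeCost m y (load p y + 1) := by
    intro i hi y
    have hpi : p i ≠ d i := by simpa [hp, hi] using hsd i
    have h := hA i hi y
    simp only [switchCost, ← hp, load_update_of_ne p i _ hpi] at h
    exact h.trans (slopeCost_mono y (load_update_le p i y))
  exact eq_of_slopeCost_eq (le_antisymm (cheapest i hi (d j)) (cheapest j hj (d i)))

theorem DCSC.card_sub_le {ι : Type*} [Fintype ι] [DecidableEq ι] {m k : ℕ}
    {s d : ι → Fin m} (hsd : ∀ i, s i ≠ d i) (hd : ∀ r, load d r = k)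
    {A : Finset ι} (hA : DCSC (slopeCost m) s d A) : Fintype.card ι - k ≤ A.card := by
  have hcompl : Aᶜ.card ≤ k := by
    obtain h | ⟨i, hi⟩ := Aᶜ.eq_empty_or_nonempty
    · simp [h]
    · rw [← hd (d i)]
      refine Finset.card_le_card fun j hj => ?_
      rw [Finset.mem_compl] at hi hj
      exact Finset.mem_filter.2 ⟨Finset.mem_univ _, hA.target_eq hsd hj hi⟩
  have := A.card_add_card_compl
  omega

/-- Tightness of the `n - n/m` bound: for every `m ≥ 2` and `n` divisible by `m`,
in the singleton congestion game with resources `{1, …, m}` and cost functions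
`c_j(x) = j + m (x - 1)`, there exist Nash equilibria `s` and `d` with
`s i ≠ d i` for every player `i`, such that every direct control set w.r.t.
`(G, s, d)` has size at least `n - n/m`. -/
theorem stmt14 (m n : ℕ) (hm : 2 ≤ m) (hdvd : m ∣ n) :
    let c : Fin m → ℕ → ℝ := fun j x => ((j : ℕ) + 1 : ℝ) + (m : ℝ) * ((x : ℝ) - 1)
    ∃ s d : Fin n → Fin m,
      NashC c s ∧ NashC c d ∧ (∀ i, s i ≠ d i) ∧
      ∀ A : Finset (Fin n), DCSC c s d A → n - n / m ≤ A.card := by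
  intro c
  obtain ⟨k, rfl⟩ := hdvd
  have : NeZero m := ⟨by omega⟩
  let s : Fin (m * k) → Fin m := fun i => (finProdFinEquiv.symm i).1
  let d : Fin (m * k) → Fin m := fun i => Equiv.addRight 1 (s i)
  have hs : ∀ r, load s r = k := load_fst_finProdFinEquiv_symm m k
  have hd : ∀ r, load d r = k := fun r => (load_perm_comp s _ r).trans (hs _)
  have hsd : ∀ i, s i ≠ d i := fun i h => by simp [d] at h; omega
  refine ⟨s, d, nashC_slopeCost_of_load_eq s hs, nashC_slopeCost_of_load_eq d hd, hsd,
    fun A hA => ?_⟩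
  rw [Nat.mul_div_cancel_left k (by omega)]
  simpa using DCSC.card_sub_le hsd hd hA
end

section
/- Let G be a singleton congestion game with nondecreasing cost functions, let s be any strategy profile, let Br_i(s) denote the set of best responses of player i to s, and define the attraction basin AB(s) = ⋃_{i∈N} (Br_i(s) ∖ {s_i}). Then for all resources q, r ∈ AB(s), c_q(l_q(s) + 1) = c_r(l_r(s) + 1). -/
/-- The attraction basin of a profile `s`: the union over the players `i` of
`Br_i(s) ∖ {s i}`. -/
def AB {ι ρ : Type*} [Fintype ι] [DecidableEq ι] [DecidableEq ρ]
    (c : ρ → ℕ → ℝ) (s : ι → ρ) : Set ρ :=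
  ⋃ i : ι, {x : ρ | IsBR c i x s ∧ x ≠ s i}

theorem load_update_self {ι ρ : Type*} [Fintype ι] [DecidableEq ι] [DecidableEq ρ]
    (s : ι → ρ) {i : ι} {x : ρ} (h : x ≠ s i) :
    load (Function.update s i x) x = load s x + 1 := by
  have hset : Finset.univ.filter (fun j => Function.update s i x j = x) =
      insert i (Finset.univ.filter (fun j => s j = x)) := by
    ext j
    by_cases hj : j = i <;> simp [Function.update_apply, hj]
  unfold load
  rw [hset, Finset.card_insert_of_notMem (by simpa using h.symm)]

theorem switchCost_of_ne {ι ρ : Type*} [Fintype ι] [DecidableEq ι] [DecidableEq ρ]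
    (c : ρ → ℕ → ℝ) (s : ι → ρ) {i : ι} {x : ρ} (h : x ≠ s i) :
    switchCost c s i x = c x (load s x + 1) := by
  rw [switchCost, load_update_self s h]

theorem switchCost_le {ι ρ : Type*} [Fintype ι] [DecidableEq ι] [DecidableEq ρ]
    (c : ρ → ℕ → ℝ) (hmono : ∀ r, Monotone (c r)) (s : ι → ρ) (i : ι) (x : ρ) :
    switchCost c s i x ≤ c x (load s x + 1) := by
  by_cases h : x = s i
  · subst h
    rw [switchCost, Function.update_eq_self]
    exact hmono _ (Nat.le_succ _)
  · exact (switchCost_of_ne c s h).le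

theorem marginalCost_le_of_mem_AB {ι ρ : Type*} [Fintype ι] [DecidableEq ι] [DecidableEq ρ]
    (c : ρ → ℕ → ℝ) (hmono : ∀ r, Monotone (c r)) (s : ι → ρ)
    {q : ρ} (hq : q ∈ AB c s) (r : ρ) :
    c q (load s q + 1) ≤ c r (load s r + 1) := by
  obtain ⟨i, hbr, hne⟩ := Set.mem_iUnion.mp hq
  rw [← switchCost_of_ne c s hne]
  exact (hbr r).trans (switchCost_le c hmono s i r)

/-- In a singleton congestion game with nondecreasing costs, all resources of the
attraction basin of a profile `s` have equal marginal costs: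
`c_q(l_q(s) + 1) = c_r(l_r(s) + 1)` for all `q, r ∈ AB(s)`. -/
theorem stmt15 {ι ρ : Type*} [Fintype ι] [DecidableEq ι] [Fintype ρ] [DecidableEq ρ]
    (c : ρ → ℕ → ℝ) (hmono : ∀ r, Monotone (c r)) (s : ι → ρ)
    (q r : ρ) (hq : q ∈ AB c s) (hr : r ∈ AB c s) :
    c q (load s q + 1) = c r (load s r + 1) :=
  (marginalCost_le_of_mem_AB c hmono s hq r).antisymm (marginalCost_le_of_mem_AB c hmono s hr q)
end

section
/- Let G be a symmetric congestion game: a finite player set N, a finite resource set R, a common strategy set Σ ⊆ 2^R for all players, and for each resource r a strictly decreasing and positive cost function c_r : ℕ → ℝ; in a profile s, the load l_r(s) = |{j ∈ N : r ∈ s_j}|, player i's cost is C_i(s) = Σ_{r∈s_i} c_r(l_r(s)), and each player seeks to minimize cost. Then in every Nash equilibrium d of G, all players play identical strategies: d_i = d_j for all players i, j. -/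
/-- The load of resource `r` in a profile `s` of a congestion game. -/
def loadF {ι ρ : Type*} [Fintype ι] [DecidableEq ρ] (s : ι → Finset ρ) (r : ρ) : ℕ :=
  (Finset.univ.filter (fun j => r ∈ s j)).card

/-- Player `i`'s cost in profile `s`: the sum over the resources she uses of their
costs at the current loads. -/
def cost {ι ρ : Type*} [Fintype ι] [DecidableEq ρ]
    (c : ρ → ℕ → ℝ) (s : ι → Finset ρ) (i : ι) : ℝ :=
  ∑ r ∈ s i, c r (loadF s r)

/-- When a player copies the strategy `t`, the load of each resource in `t` does not decrease. -/
theorem loadF_le_loadF_update {ι ρ : Type*} [Fintype ι] [DecidableEq ι] [DecidableEq ρ]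
    (d : ι → Finset ρ) (i : ι) {t : Finset ρ} {r : ρ} (hr : r ∈ t) :
    loadF d r ≤ loadF (Function.update d i t) r := by
  refine Finset.card_le_card fun k hk => ?_
  by_cases h : k = i
  · subst h
    simpa using hr
  · simpa [h] using hk

/-- When a player copies the strategy `t`, the load of each resource in `t` that she did not use
before strictly increases. -/
theorem loadF_lt_loadF_update {ι ρ : Type*} [Fintype ι] [DecidableEq ι] [DecidableEq ρ]
    (d : ι → Finset ρ) (i : ι) {t : Finset ρ} {r : ρ} (hr : r ∈ t) (hri : r ∉ d i) :
    loadF d r < loadF (Function.update d i t) r := by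
  refine Finset.card_lt_card ((Finset.ssubset_iff_of_subset fun k hk => ?_).2
    ⟨i, by simpa using hr, by simpa using hri⟩)
  by_cases h : k = i
  · subst h
    simpa using hr
  · simpa [h] using hk

/-- With decreasing costs, a player copying `j` pays at most what `j` paid before. -/
theorem cost_update_le_cost {ι ρ : Type*} [Fintype ι] [DecidableEq ι] [DecidableEq ρ]
    {c : ρ → ℕ → ℝ} (hdec : ∀ r, StrictAnti (c r)) (d : ι → Finset ρ) (i j : ι) :
    cost c (Function.update d i (d j)) i ≤ cost c d j := by
  simp only [cost, Function.update_self]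
  exact Finset.sum_le_sum fun r hr => (hdec r).antitone (loadF_le_loadF_update d i hr)

/-- With strictly decreasing costs, a player copying `j` pays strictly less than `j` paid before
if `j` uses a resource that the copying player did not use. -/
theorem cost_update_lt_cost {ι ρ : Type*} [Fintype ι] [DecidableEq ι] [DecidableEq ρ]
    {c : ρ → ℕ → ℝ} (hdec : ∀ r, StrictAnti (c r)) (d : ι → Finset ρ) {i j : ι}
    (h : ¬ d j ⊆ d i) :
    cost c (Function.update d i (d j)) i < cost c d j := by
  obtain ⟨r, hrj, hri⟩ := Finset.not_subset.1 h
  simp only [cost, Function.update_self]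
  exact Finset.sum_lt_sum
    (fun r hr => (hdec r).antitone (loadF_le_loadF_update d i hr))
    ⟨r, hrj, hdec r (loadF_lt_loadF_update d i hrj hri)⟩

/-- In a symmetric congestion game with strictly decreasing positive costs, in
every Nash equilibrium all the players play identical strategies. -/
theorem stmt16 {ι ρ : Type*} [Fintype ι] [DecidableEq ι] [Fintype ρ] [DecidableEq ρ]
    (Strat : Finset (Finset ρ)) (c : ρ → ℕ → ℝ)
    (hdec : ∀ r, StrictAnti (c r)) (hpos : ∀ r x, 0 < c r x)
    (d : ι → Finset ρ) (hdStrat : ∀ i, d i ∈ Strat)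
    (hNash : ∀ (i : ι), ∀ t ∈ Strat, cost c d i ≤ cost c (Function.update d i t) i) :
    ∀ i j : ι, d i = d j := by
  have hsub : ∀ i j, d j ⊆ d i := fun i j => by
    by_contra h
    exact ((hNash i _ (hdStrat j)).trans_lt (cost_update_lt_cost hdec d h)).not_ge
      ((hNash j _ (hdStrat i)).trans (cost_update_le_cost hdec d j i))
  exact fun i j => (hsub j i).antisymm (hsub i j)
end

section
/- Let G = (V, E) be a finite graph with |V| = n and let k be an integer with k < n. Define the game with player set V ∪ {0} (where 0 ∉ V), strategy sets S_i = {0, 1} for all players, utility u_j ≡ 0 for every j ∈ V, and utility of player 0 given by u_0(x) = 0 if {i ∈ V : x_i = 1} is a dominating set of G of size at most k and x_0 = 1, and u_0(x) = 1 otherwise. Then: the all-0 profile and the all-1 profile are Nash equilibria of this game, and for every F ⊆ V, strategy 1 fails to be a best response of player 0 to the profile in which exactly the players in F play 1 and the players in V ∖ F play 0 if and only if F is a dominating set of G with |F| ≤ k. -/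
open scoped Classical in
/-- The game reducing Dominating Set to (non-)best-response verification: players
are `V ∪ {0}` (player `0` is `none`), all with strategies `{0, 1}` (`Bool`);
players in `V` have utility identically `0`, and player `0` gets `0` if the set of
`V`-players playing `1` is a dominating set of size at most `k` and she plays `1`,
and `1` otherwise. The all-`0` and all-`1` profiles are Nash equilibria, and for
every `F ⊆ V`, strategy `1` fails to be a best response of player `0` to the
profile where exactly the players of `F` play `1` iff `F` is a dominating set of
`G` with `|F| ≤ k`. -/
theorem stmt19 {V : Type*} [Fintype V] [DecidableEq V] (G : SimpleGraph V)
    (k : ℕ) (hk : k < Fintype.card V) :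
    let Dom : Finset V → Prop := fun D => ∀ v ∉ D, ∃ w ∈ D, G.Adj v w
    let u : Option V → ((Option V → Bool) → ℝ) := fun p x =>
      match p with
      | some _ => 0
      | none =>
          if Dom (Finset.univ.filter (fun i : V => x (some i) = true)) ∧
              (Finset.univ.filter (fun i : V => x (some i) = true)).card ≤ k ∧
              x none = true
          then 0 else 1
    NashEq u (fun _ => false) ∧ NashEq u (fun _ => true) ∧
      ∀ F : Finset V,
        (¬ BestResponse u none true
            (fun o : Option V =>
              match o with
              | some i => decide (i ∈ F)
              | none => false)) ↔
          (Dom F ∧ F.card ≤ k) := by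
  intro Dom u
  have u_none (x : Option V → Bool) : u none x =
      if Dom (Finset.univ.filter (fun i : V => x (some i) = true)) ∧
          (Finset.univ.filter (fun i : V => x (some i) = true)).card ≤ k ∧ x none = true
        then 0 else 1 := rfl
  have u_le (x : Option V → Bool) : u none x ≤ 1 := by
    rw [u_none]
    split_ifs <;> norm_num
  have best_none (t : Option V → Bool) (b : Bool) (h : u none (Function.update t none b) = 1) :
      BestResponse u none b t := fun y => (u_le _).trans_eq h.symm
  have u_false (t : Option V → Bool) : u none (Function.update t none false) = 1 := by
    simp [u_none]
  refine ⟨?_, ?_, fun F => ?_⟩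
  · rintro (_ | v)
    · exact best_none _ _ (u_false _)
    · exact fun _ => le_rfl
  · rintro (_ | v)
    · refine best_none _ _ ?_
      simp [u_none, hk]
    · exact fun _ => le_rfl
  · set t : Option V → Bool := fun o =>
      match o with
      | some i => decide (i ∈ F)
      | none => false with ht
    have u_true : u none (Function.update t none true) =
        if Dom F ∧ F.card ≤ k then 0 else 1 := by
      simp [u_none, ht]
    constructor
    · intro h
      by_contra hF
      exact h (best_none _ _ (by rw [u_true, if_neg hF]))
    · intro hF h
      have := h false
      rw [u_false, u_true, if_pos hF] at this
      norm_num at this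
end
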